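/- arXiv:1008.1384 — 10 statements merged into one kernel-verified Lean document; each statement's English description precedes it below -/
import Mathlib

section
/- The binary operation ⋆ defined by g ⋆ h = g₊ h₊ (g₋ h₋)⁻¹ makes the set G into a group: ⋆ is associative, the identity element e of G is a two-sided identity for ⋆, and every g ∈ G has the ⋆-inverse i(g) = g₊⁻¹ g₋. -/
/-- In a factorizable group `G` (every `g` factors uniquely as
`g = g₊ * g₋⁻¹` with `g₊ ∈ G₊`, `g₋ ∈ G₋`), the operation
`g ⋆ h = g₊ h₊ (g₋ h₋)⁻¹` makes `G` into a group: it is associative, the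
identity of `G` is a two-sided identity for `⋆`, and `i(g) = g₊⁻¹ g₋` is a
two-sided `⋆`-inverse of `g`. -/
theorem stmt_0 {G : Type*} [Group G] (Gp Gm : Subgroup G)
    (pos neg : G → G)
    (hpos : ∀ g, pos g ∈ Gp) (hneg : ∀ g, neg g ∈ Gm)
    (hfact : ∀ g, g = pos g * (neg g)⁻¹)
    (huniq : ∀ g a b, a ∈ Gp → b ∈ Gm → g = a * b⁻¹ → a = pos g ∧ b = neg g)
    (star : G → G → G)
    (hstar : ∀ g h, star g h = pos g * pos h * (neg g * neg h)⁻¹) :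
    (∀ g h k, star (star g h) k = star g (star h k)) ∧
    (∀ g, star 1 g = g ∧ star g 1 = g) ∧
    (∀ g, star g ((pos g)⁻¹ * neg g) = 1 ∧ star ((pos g)⁻¹ * neg g) g = 1) := by
  have star_parts : ∀ g h, pos (star g h) = pos g * pos h ∧ neg (star g h) = neg g * neg h := by
    intro g h
    obtain ⟨hp, hn⟩ := huniq (star g h) _ _ (mul_mem (hpos g) (hpos h))
      (mul_mem (hneg g) (hneg h)) (hstar g h)
    exact ⟨hp.symm, hn.symm⟩
  obtain ⟨pos_one, neg_one⟩ := huniq 1 1 1 (one_mem Gp) (one_mem Gm) (by simp)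
  have inv_parts : ∀ g, (pos g)⁻¹ = pos ((pos g)⁻¹ * neg g) ∧
      (neg g)⁻¹ = neg ((pos g)⁻¹ * neg g) := fun g =>
    huniq _ _ _ (inv_mem (hpos g)) (inv_mem (hneg g)) (by rw [inv_inv])
  refine ⟨fun g h k => ?_, fun g => ⟨?_, ?_⟩, fun g => ⟨?_, ?_⟩⟩
  · rw [hstar (star g h), hstar g (star h k), (star_parts g h).1, (star_parts g h).2,
      (star_parts h k).1, (star_parts h k).2, mul_assoc (pos g), mul_assoc (neg g)]
  · rw [hstar, ← pos_one, ← neg_one, one_mul, one_mul, ← hfact]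
  · rw [hstar, ← pos_one, ← neg_one, mul_one, mul_one, ← hfact]
  · rw [hstar, ← (inv_parts g).1, ← (inv_parts g).2]
    simp
  · rw [hstar, ← (inv_parts g).1, ← (inv_parts g).2]
    simp
end

section
/- (Weinstein–Xu) The map ℛ : G × G → G × G defined by ℛ(x,y) = (x_L(y,x), x_R(y,x)) satisfies the set-theoretical Yang–Baxter equation: ℛ₁₂ ∘ ℛ₁₃ ∘ ℛ₂₃ = ℛ₂₃ ∘ ℛ₁₃ ∘ ℛ₁₂ as maps from G × G × G to itself. -/
/-- A second associative, left cancellative product `o` on a group, related to the group law by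
`o a b = a * t a b` for an action `t` of `(G, o)` by endomorphisms, yields a braiding
`(a, b) ↦ (t a b, s a b)`, written here componentwise. -/
theorem braid_of_action {G : Type*} [Group G] (o : G → G → G) (t : G → G →* G) (s : G → G → G)
    (assoc : ∀ a b c, o (o a b) c = o a (o b c))
    (cancel : ∀ a b c, o a b = o a c → b = c)
    (act : ∀ a b x, t (o a b) x = t a (t b x))
    (mul_act : ∀ a b, o a b = a * t a b)
    (braid : ∀ a b, o (t a b) (s a b) = o a b) (x y z : G) :
    t (t z y) (t (s z y) x) = t z (t y x) ∧
    s (t z y) (t (s z y) x) = t (s z (t y x)) (s y x) ∧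
    s (s z y) x = s (s z (t y x)) (s y x) := by
  have h1 : t (t z y) (t (s z y) x) = t z (t y x) := by
    rw [← act, braid, act]
  have h2 : s (t z y) (t (s z y) x) = t (s z (t y x)) (s y x) := by
    apply cancel (t z (t y x))
    have e : t (t y x) (s y x) = (t y x)⁻¹ * (y * t y x) := by
      rw [eq_inv_mul_iff_mul_eq, ← mul_act, braid, mul_act]
    calc o (t z (t y x)) (s (t z y) (t (s z y) x))
        = t z y * t z (t y x) := by rw [← h1, braid, mul_act]
      _ = t z (t y x) * t z (t (t y x) (s y x)) := by
        rw [e, map_mul, map_mul, map_inv, mul_inv_cancel_left]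
      _ = o (t z (t y x)) (t (s z (t y x)) (s y x)) := by
        rw [mul_act, ← act (t z (t y x)), braid, act]
  refine ⟨h1, h2, ?_⟩
  apply cancel (t (s z (t y x)) (s y x))
  apply cancel (t z (t y x))
  calc o (t z (t y x)) (o (t (s z (t y x)) (s y x)) (s (s z y) x))
      = o z (o y x) := by
        rw [← h2, ← h1, ← assoc, braid, assoc, braid, ← assoc, braid, assoc]
    _ = o (t z (t y x)) (o (t (s z (t y x)) (s y x)) (s (s z (t y x)) (s y x))) := by
        rw [braid, ← assoc (t z (t y x)), braid, assoc, braid]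

/-- Weinstein–Xu: For a factorizable group `G`, the map
`ℛ(x, y) = (x_L(y, x), x_R(y, x))`, where `x_L(x,y) = x₋ y x₋⁻¹` and
`x_R(x,y) = (x_L(x,y))₊⁻¹ x (x_L(x,y))₊`, satisfies the set-theoretical
Yang–Baxter equation `ℛ₁₂ ∘ ℛ₁₃ ∘ ℛ₂₃ = ℛ₂₃ ∘ ℛ₁₃ ∘ ℛ₁₂` on `G × G × G`. -/
theorem stmt_2 {G : Type*} [Group G] (Gp Gm : Subgroup G)
    (pos neg : G → G)
    (hpos : ∀ g, pos g ∈ Gp) (hneg : ∀ g, neg g ∈ Gm)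
    (hfact : ∀ g, g = pos g * (neg g)⁻¹)
    (huniq : ∀ g a b, a ∈ Gp → b ∈ Gm → g = a * b⁻¹ → a = pos g ∧ b = neg g)
    (xL xR : G → G → G)
    (hxL : ∀ x y, xL x y = neg x * y * (neg x)⁻¹)
    (hxR : ∀ x y, xR x y = (pos (xL x y))⁻¹ * x * pos (xL x y))
    (R : G × G → G × G)
    (hR : ∀ x y, R (x, y) = (xL y x, xR y x))
    (R12 R13 R23 : G × G × G → G × G × G)
    (hR12 : ∀ x y z, R12 (x, y, z) = ((R (x, y)).1, (R (x, y)).2, z))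
    (hR13 : ∀ x y z, R13 (x, y, z) = ((R (x, z)).1, y, (R (x, z)).2))
    (hR23 : ∀ x y z, R23 (x, y, z) = (x, (R (y, z)).1, (R (y, z)).2)) :
    R12 ∘ R13 ∘ R23 = R23 ∘ R13 ∘ R12 := by
  have pos_eq (g : G) : pos g = g * neg g := mul_inv_eq_iff_eq_mul.mp (hfact g).symm
  have fact_o (a b : G) : pos a * b * (neg a)⁻¹ = pos a * pos b * (neg a * neg b)⁻¹ := by
    conv_lhs => rw [hfact b]
    group
  have pos_o (a b : G) : pos (pos a * b * (neg a)⁻¹) = pos a * pos b :=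
    (huniq _ _ _ (Gp.mul_mem (hpos a) (hpos b)) (Gm.mul_mem (hneg a) (hneg b))
      (fact_o a b)).1.symm
  have neg_o (a b : G) : neg (pos a * b * (neg a)⁻¹) = neg a * neg b :=
    (huniq _ _ _ (Gp.mul_mem (hpos a) (hpos b)) (Gm.mul_mem (hneg a) (hneg b))
      (fact_o a b)).2.symm
  have key := braid_of_action (fun a b => pos a * b * (neg a)⁻¹)
    (fun a => (MulAut.conj (neg a)).toMonoidHom) xR
    (fun a b c => by simp only [pos_o, neg_o]; group)
    (fun a b c h => by simpa using h)
    (fun a b x => by simp only [neg_o]; simp [mul_assoc])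
    (fun a b => by simp [pos_eq, mul_assoc])
    (fun a b => by
      simp only [MulEquiv.toMonoidHom_eq_coe, MonoidHom.coe_coe, MulAut.conj_apply, ← hxL]
      rw [hxR, mul_assoc (_)⁻¹, mul_inv_cancel_left, mul_assoc, ← hfact, hxL, pos_eq a]
      group)
  simp only [MulEquiv.toMonoidHom_eq_coe, MonoidHom.coe_coe, MulAut.conj_apply, ← hxL] at key
  funext ⟨x, y, z⟩
  obtain ⟨h1, h2, h3⟩ := key x y z
  simp only [Function.comp_apply, hR12, hR13, hR23, hR, h1, h2, h3]
end

section
/- For all x, y ∈ G one has x_L(x,y) ⋆ x_R(x,y) = x ⋆ y. (This is the identity m ∘ ℛ = m', where m is the ⋆-multiplication and m' the opposite ⋆-multiplication.) -/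
/-- In a factorizable group `G`,
`x_L(x,y) ⋆ x_R(x,y) = x ⋆ y` for all `x, y ∈ G` (the identity `m ∘ ℛ = m'`
for the braided group `(G, ⋆)`). -/
theorem stmt_3 {G : Type*} [Group G] (Gp Gm : Subgroup G)
    (pos neg : G → G)
    (hpos : ∀ g, pos g ∈ Gp) (hneg : ∀ g, neg g ∈ Gm)
    (hfact : ∀ g, g = pos g * (neg g)⁻¹)
    (huniq : ∀ g a b, a ∈ Gp → b ∈ Gm → g = a * b⁻¹ → a = pos g ∧ b = neg g)
    (star : G → G → G)
    (hstar : ∀ g h, star g h = pos g * pos h * (neg g * neg h)⁻¹)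
    (xL xR : G → G → G)
    (hxL : ∀ x y, xL x y = neg x * y * (neg x)⁻¹)
    (hxR : ∀ x y, xR x y = (pos (xL x y))⁻¹ * x * pos (xL x y)) :
    ∀ x y, star (xL x y) (xR x y) = star x y := by
  intro x y
  have hp : pos (xL x y) = neg x * pos y * (neg y)⁻¹ * (neg x)⁻¹ * neg (xL x y) := by
    rw [← mul_inv_eq_iff_eq_mul, ← hfact (xL x y), hxL, mul_assoc (neg x) (pos y), ← hfact y]
  have hR : xR x y = ((pos (xL x y))⁻¹ * pos x * pos y) *
      ((neg (xL x y))⁻¹ * neg x * neg y)⁻¹ := by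
    calc xR x y = (pos (xL x y))⁻¹ * (pos x * (neg x)⁻¹) * pos (xL x y) := by
          rw [hxR, ← hfact x]
      _ = (pos (xL x y))⁻¹ * (pos x * (neg x)⁻¹) *
          (neg x * pos y * (neg y)⁻¹ * (neg x)⁻¹ * neg (xL x y)) := by rw [← hp]
      _ = _ := by group
  obtain ⟨h₁, h₂⟩ := huniq _ _ _
    (mul_mem (mul_mem (inv_mem (hpos (xL x y))) (hpos x)) (hpos y))
    (mul_mem (mul_mem (inv_mem (hneg (xL x y))) (hneg x)) (hneg y)) hR
  rw [hstar, hstar, ← h₁, ← h₂]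
  group
end

section
/- For all x, y, z ∈ G one has x_L(x, y ⋆ z) = x_L(x,y) ⋆ x_L(x_R(x,y), z). -/
/-- In a factorizable group `G`,
`x_L(x, y ⋆ z) = x_L(x,y) ⋆ x_L(x_R(x,y), z)` for all `x, y, z ∈ G`. -/
theorem stmt_4 {G : Type*} [Group G] (Gp Gm : Subgroup G)
    (pos neg : G → G)
    (hpos : ∀ g, pos g ∈ Gp) (hneg : ∀ g, neg g ∈ Gm)
    (hfact : ∀ g, g = pos g * (neg g)⁻¹)
    (huniq : ∀ g a b, a ∈ Gp → b ∈ Gm → g = a * b⁻¹ → a = pos g ∧ b = neg g)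
    (star : G → G → G)
    (hstar : ∀ g h, star g h = pos g * pos h * (neg g * neg h)⁻¹)
    (xL xR : G → G → G)
    (hxL : ∀ x y, xL x y = neg x * y * (neg x)⁻¹)
    (hxR : ∀ x y, xR x y = (pos (xL x y))⁻¹ * x * pos (xL x y)) :
    ∀ x y z, xL x (star y z) = star (xL x y) (xL (xR x y) z) := by
  intro x y z
  have star_eq (g h : G) : star g h = pos g * h * (neg g)⁻¹ := by
    conv_rhs => rw [hfact h]
    rw [hstar]
    group
  set u := xL x y with hu
  have conj_eq : pos u * (neg u)⁻¹ = neg x * (pos y * (neg y)⁻¹) * (neg x)⁻¹ := by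
    rw [← hfact u, ← hfact y, hu, hxL]
  have neg_xR : neg (xR x y) = (neg u)⁻¹ * neg x * neg y := by
    refine (huniq _ ((pos u)⁻¹ * pos x * pos y) _ ?_ ?_ ?_).2.symm
    · exact Gp.mul_mem (Gp.mul_mem (Gp.inv_mem (hpos u)) (hpos x)) (hpos y)
    · exact Gm.mul_mem (Gm.mul_mem (Gm.inv_mem (hneg u)) (hneg x)) (hneg y)
    · have pos_u : pos u = neg x * (pos y * (neg y)⁻¹) * (neg x)⁻¹ * neg u :=
        mul_inv_eq_iff_eq_mul.mp conj_eq
      calc xR x y = (pos u)⁻¹ * (pos x * (neg x)⁻¹) * pos u := by rw [← hfact x, hxR]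
        _ = (pos u)⁻¹ * (pos x * (neg x)⁻¹) *
            (neg x * (pos y * (neg y)⁻¹) * (neg x)⁻¹ * neg u) := by
          congr 1
        _ = _ := by group
  calc xL x (star y z)
      = neg x * (pos y * (neg y)⁻¹) * (neg x)⁻¹ * (neg x * neg y * z * (neg y)⁻¹ * (neg x)⁻¹) := by
        rw [hxL, star_eq]
        group
    _ = pos u * (neg u)⁻¹ * (neg x * neg y * z * (neg y)⁻¹ * (neg x)⁻¹) := by rw [conj_eq]
    _ = star u (xL (xR x y) z) := by
        rw [star_eq, hxL (xR x y), neg_xR]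
        group
end

section
/- For all x, y, z ∈ G one has x_R(x, y ⋆ z) = x_R(x_R(x,y), z). -/
/-- In a factorizable group `G`,
`x_R(x, y ⋆ z) = x_R(x_R(x,y), z)` for all `x, y, z ∈ G`. -/
theorem stmt_5 {G : Type*} [Group G] (Gp Gm : Subgroup G)
    (pos neg : G → G)
    (hpos : ∀ g, pos g ∈ Gp) (hneg : ∀ g, neg g ∈ Gm)
    (hfact : ∀ g, g = pos g * (neg g)⁻¹)
    (huniq : ∀ g a b, a ∈ Gp → b ∈ Gm → g = a * b⁻¹ → a = pos g ∧ b = neg g)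
    (star : G → G → G)
    (hstar : ∀ g h, star g h = pos g * pos h * (neg g * neg h)⁻¹)
    (xL xR : G → G → G)
    (hxL : ∀ x y, xL x y = neg x * y * (neg x)⁻¹)
    (hxR : ∀ x y, xR x y = (pos (xL x y))⁻¹ * x * pos (xL x y)) :
    ∀ x y z, xR x (star y z) = xR (xR x y) z := by
  have pos_mul_right : ∀ g b, b ∈ Gm → pos (g * b) = pos g := fun g b hb =>
    ((huniq (g * b) (pos g) (b⁻¹ * neg g) (hpos g)
      (Gm.mul_mem (Gm.inv_mem hb) (hneg g)) (by
        conv_lhs => rw [hfact g]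
        group)).1).symm
  have pos_mul_left : ∀ a g, a ∈ Gp → pos (a * g) = a * pos g := fun a g ha =>
    ((huniq (a * g) (a * pos g) (neg g) (Gp.mul_mem ha (hpos g)) (hneg g) (by
        conv_lhs => rw [hfact g]
        group)).1).symm
  have pos_xL : ∀ x y, pos (xL x y) = pos (neg x * pos y) := fun x y => by
    have h : xL x y = neg x * pos y * ((neg y)⁻¹ * (neg x)⁻¹) := by
      rw [hxL]
      conv_lhs => rw [hfact y]
      group
    rw [h, pos_mul_right _ _ (Gm.mul_mem (Gm.inv_mem (hneg y)) (Gm.inv_mem (hneg x)))]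
  intro x y z
  have pos_star : pos (star y z) = pos y * pos z :=
    (huniq _ _ _ (Gp.mul_mem (hpos y) (hpos z)) (Gm.mul_mem (hneg y) (hneg z))
      (hstar y z)).1.symm
  set p := pos (neg x * pos y) with hp
  set n := neg (neg x * pos y) with hn
  have hpn : neg x * pos y = p * n⁻¹ := hfact _
  have neg_xR : neg (xR x y) = n⁻¹ := by
    refine (huniq _ (p⁻¹ * pos x * pos y) n⁻¹
      (Gp.mul_mem (Gp.mul_mem (Gp.inv_mem (hpos _)) (hpos x)) (hpos y))
      (Gm.inv_mem (hneg _)) ?_).2.symm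
    have h : p = neg x * pos y * n := by rw [hpn]; group
    have hx : x * p = pos x * pos y * n := by
      conv_lhs => rw [hfact x, h]
      group
    rw [hxR, pos_xL, ← hp, mul_assoc, hx]
    group
  have pos_xL_star : pos (xL x (star y z)) = p * pos (n⁻¹ * pos z) := by
    rw [pos_xL, pos_star, ← mul_assoc, hpn, mul_assoc, pos_mul_left _ _ (hpos _)]
  rw [hxR x (star y z), hxR (xR x y) z, pos_xL_star, pos_xL (xR x y) z, neg_xR, hxR x y,
    pos_xL x y, ← hp]
  group
end

section
/- The pair (G, ℛ), where G carries the ⋆-multiplication m(x,y) = x ⋆ y, satisfies the second braided-group axiom: ℛ ∘ (m × id) = (m × id) ∘ ℛ₂₃ ∘ ℛ₁₃ as maps from G × G × G to G × G × G. -/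
/-- For a factorizable group `G` with `⋆`-multiplication `m` and
`ℛ(x,y) = (x_L(y,x), x_R(y,x))`, the second braided-group axiom holds:
`ℛ ∘ (m × id) = (m × id) ∘ ℛ₂₃ ∘ ℛ₁₃` as maps `G × G × G → G × G`. -/
theorem stmt_7 {G : Type*} [Group G] (Gp Gm : Subgroup G)
    (pos neg : G → G)
    (hpos : ∀ g, pos g ∈ Gp) (hneg : ∀ g, neg g ∈ Gm)
    (hfact : ∀ g, g = pos g * (neg g)⁻¹)
    (huniq : ∀ g a b, a ∈ Gp → b ∈ Gm → g = a * b⁻¹ → a = pos g ∧ b = neg g)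
    (star : G → G → G)
    (hstar : ∀ g h, star g h = pos g * pos h * (neg g * neg h)⁻¹)
    (xL xR : G → G → G)
    (hxL : ∀ x y, xL x y = neg x * y * (neg x)⁻¹)
    (hxR : ∀ x y, xR x y = (pos (xL x y))⁻¹ * x * pos (xL x y))
    (R : G × G → G × G)
    (hR : ∀ x y, R (x, y) = (xL y x, xR y x))
    (R13 R23 : G × G × G → G × G × G)
    (hR13 : ∀ x y z, R13 (x, y, z) = ((R (x, z)).1, y, (R (x, z)).2))
    (hR23 : ∀ x y z, R23 (x, y, z) = (x, (R (y, z)).1, (R (y, z)).2))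
    (mid : G × G × G → G × G)
    (hmid : ∀ x y z, mid (x, y, z) = (star x y, z)) :
    R ∘ mid = mid ∘ R23 ∘ R13 := by
  funext ⟨x, y, z⟩
  have xR_neg : neg (xR z x) = (neg (xL z x))⁻¹ * neg z * neg x := by
    have hu : pos (xL z x) = neg z * pos x * (neg x)⁻¹ * (neg z)⁻¹ * neg (xL z x) := by
      have h := (hfact (xL z x)).symm.trans (hxL z x)
      rw [mul_inv_eq_iff_eq_mul] at h
      rw [h]
      nth_rewrite 1 [hfact x]
      group
    refine (huniq (xR z x) ((pos (xL z x))⁻¹ * pos z * pos x) _ ?_ ?_ ?_).2.symm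
    · exact Gp.mul_mem (Gp.mul_mem (Gp.inv_mem (hpos _)) (hpos _)) (hpos _)
    · exact Gm.mul_mem (Gm.mul_mem (Gm.inv_mem (hneg _)) (hneg _)) (hneg _)
    · rw [hxR]
      nth_rewrite 2 [hfact z]
      nth_rewrite 2 [hu]
      group
  have star_eq (g h : G) : star g h = pos g * h * (neg g)⁻¹ := by
    rw [hstar]
    nth_rewrite 3 [hfact h]
    group
  have pos_star (g h : G) : pos (star g h) = pos g * pos h :=
    (huniq _ _ _ (Gp.mul_mem (hpos g) (hpos h)) (Gm.mul_mem (hneg g) (hneg h))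
      (hstar g h)).1.symm
  have xL_star : xL z (star x y) = star (xL z x) (xL (xR z x) y) := by
    have h : pos (xL z x) = xL z x * neg (xL z x) :=
      mul_inv_eq_iff_eq_mul.mp (hfact (xL z x)).symm
    have hx : pos x = x * neg x := mul_inv_eq_iff_eq_mul.mp (hfact x).symm
    rw [star_eq, star_eq, hxL (xR z x) y, xR_neg, h, hxL z (_ * _), hx]
    nth_rewrite 1 [hxL z x]
    group
  have xR_star : xR z (star x y) = xR (xR z x) y := by
    rw [hxR z (star x y), xL_star, pos_star, hxR (xR z x) y]
    nth_rewrite 4 [hxR z x]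
    group
  simp only [Function.comp_apply, hmid, hR13, hR23, hR, xL_star, xR_star]
end

section
/- The pair (G, ℛ), where G carries the ⋆-multiplication m(x,y) = x ⋆ y, satisfies the third braided-group axiom: ℛ ∘ (id × m) = (id × m) ∘ ℛ₁₂ ∘ ℛ₁₃ as maps from G × G × G to G × G × G. -/
/-- In a factorizable group, the factors of `w` conjugated by the positive part of `v = w₋ x w₋⁻¹`
are `v₊⁻¹ w₊ x₊` and `v₋⁻¹ w₋ x₋`. -/
theorem factors_conj_pos {G : Type*} [Group G] {Gp Gm : Subgroup G} {pos neg : G → G}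
    (hpos : ∀ g, pos g ∈ Gp) (hneg : ∀ g, neg g ∈ Gm)
    (hfact : ∀ g, g = pos g * (neg g)⁻¹)
    (huniq : ∀ g a b, a ∈ Gp → b ∈ Gm → g = a * b⁻¹ → a = pos g ∧ b = neg g)
    {x w v : G} (hv : v = neg w * x * (neg w)⁻¹) :
    pos ((pos v)⁻¹ * w * pos v) = (pos v)⁻¹ * pos w * pos x ∧
      neg ((pos v)⁻¹ * w * pos v) = (neg v)⁻¹ * neg w * neg x := by
  have hvx : pos v * (neg v)⁻¹ = neg w * (pos x * (neg x)⁻¹) * (neg w)⁻¹ := by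
    rw [← hfact, ← hfact, hv]
  have hconj : (pos v)⁻¹ * w * pos v =
      (pos v)⁻¹ * pos w * pos x * ((neg v)⁻¹ * neg w * neg x)⁻¹ :=
    calc (pos v)⁻¹ * w * pos v
        = (pos v)⁻¹ * (pos w * (neg w)⁻¹) * (pos v * (neg v)⁻¹) * neg v := by
          rw [← hfact w]; group
      _ = _ := by rw [hvx]; group
  have h := huniq _ _ _
    (mul_mem (mul_mem (inv_mem (hpos v)) (hpos w)) (hpos x))
    (mul_mem (mul_mem (inv_mem (hneg v)) (hneg w)) (hneg x)) hconj
  exact ⟨h.1.symm, h.2.symm⟩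

/-- For a factorizable group `G` with `⋆`-multiplication `m` and
`ℛ(x,y) = (x_L(y,x), x_R(y,x))`, the third braided-group axiom holds:
`ℛ ∘ (id × m) = (id × m) ∘ ℛ₁₂ ∘ ℛ₁₃` as maps `G × G × G → G × G`. -/
theorem stmt_8 {G : Type*} [Group G] (Gp Gm : Subgroup G)
    (pos neg : G → G)
    (hpos : ∀ g, pos g ∈ Gp) (hneg : ∀ g, neg g ∈ Gm)
    (hfact : ∀ g, g = pos g * (neg g)⁻¹)
    (huniq : ∀ g a b, a ∈ Gp → b ∈ Gm → g = a * b⁻¹ → a = pos g ∧ b = neg g)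
    (star : G → G → G)
    (hstar : ∀ g h, star g h = pos g * pos h * (neg g * neg h)⁻¹)
    (xL xR : G → G → G)
    (hxL : ∀ x y, xL x y = neg x * y * (neg x)⁻¹)
    (hxR : ∀ x y, xR x y = (pos (xL x y))⁻¹ * x * pos (xL x y))
    (R : G × G → G × G)
    (hR : ∀ x y, R (x, y) = (xL y x, xR y x))
    (R12 R13 : G × G × G → G × G × G)
    (hR12 : ∀ x y z, R12 (x, y, z) = ((R (x, y)).1, (R (x, y)).2, z))
    (hR13 : ∀ x y z, R13 (x, y, z) = ((R (x, z)).1, y, (R (x, z)).2))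
    (idm : G × G × G → G × G)
    (hidm : ∀ x y z, idm (x, y, z) = (x, star y z)) :
    R ∘ idm = idm ∘ R12 ∘ R13 := by
  funext ⟨x, y, z⟩
  obtain ⟨hwp, hwn⟩ := huniq (star y z) (pos y * pos z) (neg y * neg z)
    (mul_mem (hpos y) (hpos z)) (mul_mem (hneg y) (hneg z)) (hstar y z)
  have hcomp : xL (star y z) x = xL y (xL z x) := by
    simp only [hxL, ← hwn]
    group
  have key : ∀ x w, pos (xR w x) = (pos (xL w x))⁻¹ * pos w * pos x ∧
      neg (xR w x) = (neg (xL w x))⁻¹ * neg w * neg x := fun x w => by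
    rw [hxR]
    exact factors_conj_pos hpos hneg hfact huniq (hxL w x)
  have hright : xR (star y z) x = star (xR y (xL z x)) (xR z x) := by
    rw [hfact (xR (star y z) x), hstar (xR y (xL z x)), (key _ _).1, (key _ _).2,
      (key x z).1, (key x z).2, (key _ y).1, (key _ y).2, hcomp, ← hwp, ← hwn]
    group
  simp only [Function.comp_apply, hidm, hR13, hR12, hR, hcomp, hright]
end

section
/- Let (H, ·) be any group with multiplication m(x,y) = x·y and opposite multiplication m'(x,y) = y·x, and let ℛ : H × H → H × H be a map satisfying (1) m ∘ ℛ = m', (2) ℛ ∘ (m × id) = (m × id) ∘ ℛ₂₃ ∘ ℛ₁₃, and (3) ℛ ∘ (id × m) = (id × m) ∘ ℛ₁₂ ∘ ℛ₁₃ (i.e., (H, ℛ) is a braided group). Then ℛ satisfies the set-theoretical Yang–Baxter equation ℛ₁₂ ∘ ℛ₁₃ ∘ ℛ₂₃ = ℛ₂₃ ∘ ℛ₁₃ ∘ ℛ₁₂ on H × H × H. -/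
/-- If `(H, ·)` is a group and `ℛ : H × H → H × H` satisfies the
three braided-group axioms (1) `m ∘ ℛ = m'`, (2) `ℛ ∘ (m × id) = (m × id) ∘ ℛ₂₃ ∘ ℛ₁₃`,
(3) `ℛ ∘ (id × m) = (id × m) ∘ ℛ₁₂ ∘ ℛ₁₃`, then `ℛ` satisfies the
set-theoretical Yang–Baxter equation `ℛ₁₂ ∘ ℛ₁₃ ∘ ℛ₂₃ = ℛ₂₃ ∘ ℛ₁₃ ∘ ℛ₁₂`. -/
theorem stmt_9 {H : Type*} [Group H]
    (R : H × H → H × H)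
    (R12 R13 R23 : H × H × H → H × H × H)
    (hR12 : ∀ x y z, R12 (x, y, z) = ((R (x, y)).1, (R (x, y)).2, z))
    (hR13 : ∀ x y z, R13 (x, y, z) = ((R (x, z)).1, y, (R (x, z)).2))
    (hR23 : ∀ x y z, R23 (x, y, z) = (x, (R (y, z)).1, (R (y, z)).2))
    (mid idm : H × H × H → H × H)
    (hmid : ∀ x y z, mid (x, y, z) = (x * y, z))
    (hidm : ∀ x y z, idm (x, y, z) = (x, y * z))
    (ax1 : ∀ x y, (R (x, y)).1 * (R (x, y)).2 = y * x)
    (ax2 : R ∘ mid = mid ∘ R23 ∘ R13)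
    (ax3 : R ∘ idm = idm ∘ R12 ∘ R13) :
    R12 ∘ R13 ∘ R23 = R23 ∘ R13 ∘ R12 := by
  have act₁ : ∀ x y z, R (x * y, z) =
      ((R (x, z)).1 * (R (y, (R (x, z)).2)).1, (R (y, (R (x, z)).2)).2) := by
    intro x y z
    simpa [hmid, hR23, hR13] using congrFun ax2 (x, y, z)
  have act₂ : ∀ x y z, R (x, y * z) =
      ((R ((R (x, z)).1, y)).1, (R ((R (x, z)).1, y)).2 * (R (x, z)).2) := by
    intro x y z
    simpa [hidm, hR12, hR13] using congrFun ax3 (x, y, z)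
  funext ⟨x, y, z⟩
  simp only [Function.comp_apply, hR12, hR13, hR23]
  have fst_eq := congrArg (fun w => (R (x, w)).1) (ax1 y z)
  have snd_eq := congrArg (fun w => (R (w, z)).2) (ax1 x y)
  have prod_eq := congrArg (fun w => (R (x, w)).2) (ax1 y z)
  simp only [act₁, act₂] at fst_eq snd_eq prod_eq
  refine Prod.ext fst_eq (Prod.ext ?_ snd_eq.symm)
  apply mul_right_cancel (b := (R (x, (R (y, z)).2)).2)
  rw [prod_eq, ← snd_eq, ax1]
end

section
/- The map ℛ : G × G → G × G, ℛ(x,y) = (x_L(y,x), x_R(y,x)), is a bijection; its inverse sends (a,b) to (y₋⁻¹ a y₋, y), where y = a₊ b a₊⁻¹. -/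
/-- For a factorizable group `G`, the map
`ℛ(x,y) = (x_L(y,x), x_R(y,x))` is a bijection of `G × G`, and its inverse
sends `(a, b)` to `(y₋⁻¹ a y₋, y)` where `y = a₊ b a₊⁻¹`. -/
theorem stmt_10 {G : Type*} [Group G] (Gp Gm : Subgroup G)
    (pos neg : G → G)
    (hpos : ∀ g, pos g ∈ Gp) (hneg : ∀ g, neg g ∈ Gm)
    (hfact : ∀ g, g = pos g * (neg g)⁻¹)
    (huniq : ∀ g a b, a ∈ Gp → b ∈ Gm → g = a * b⁻¹ → a = pos g ∧ b = neg g)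
    (xL xR : G → G → G)
    (hxL : ∀ x y, xL x y = neg x * y * (neg x)⁻¹)
    (hxR : ∀ x y, xR x y = (pos (xL x y))⁻¹ * x * pos (xL x y))
    (R : G × G → G × G)
    (hR : ∀ x y, R (x, y) = (xL y x, xR y x))
    (Rinv : G × G → G × G)
    (hRinv : ∀ a b, Rinv (a, b) =
      ((neg (pos a * b * (pos a)⁻¹))⁻¹ * a * neg (pos a * b * (pos a)⁻¹),
        pos a * b * (pos a)⁻¹)) :
    Function.Bijective R ∧ (∀ p, R (Rinv p) = p) ∧ (∀ p, Rinv (R p) = p) := by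
  have right_inv : Function.RightInverse Rinv R := by
    rintro ⟨a, b⟩
    simp [hR, hRinv, hxL, hxR, mul_assoc]
  have left_inv : Function.LeftInverse Rinv R := by
    rintro ⟨x, y⟩
    simp [hR, hRinv, hxL, hxR, mul_assoc]
  exact ⟨⟨left_inv.injective, right_inv.surjective⟩, right_inv, left_inv⟩
end

section
/- Let ℓ be an odd integer with ℓ ≥ 3 and ε ∈ ℂ a primitive ℓ-th root of unity. In the algebra 𝒰_ε, the elements E^ℓ, F^ℓ, K^ℓ, K^{-ℓ}, L^ℓ, L^{-ℓ} are central: each of them commutes with all of K, K⁻¹, L, L⁻¹, E, F. (Hence they generate a central subalgebra Z₀ ⊂ 𝒰_ε.) -/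
namespace Stmt16

/-- The six generators of the free algebra: `0 ↦ K`, `1 ↦ K⁻¹`, `2 ↦ L`,
`3 ↦ L⁻¹`, `4 ↦ E`, `5 ↦ F`. -/
noncomputable def gen (i : Fin 6) : FreeAlgebra ℂ (Fin 6) :=
  FreeAlgebra.ι _ i

/-- The defining relations of the algebra `𝒰_ε` over `ℂ` (for a parameter
`ε ∈ ℂ`). -/
inductive Rel (ε : ℂ) : FreeAlgebra ℂ (Fin 6) → FreeAlgebra ℂ (Fin 6) → Prop
  | KKinv : Rel ε (gen 0 * gen 1) 1
  | KinvK : Rel ε (gen 1 * gen 0) 1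
  | LLinv : Rel ε (gen 2 * gen 3) 1
  | LinvL : Rel ε (gen 3 * gen 2) 1
  | KL : Rel ε (gen 0 * gen 2) (gen 2 * gen 0)
  | KE : Rel ε (gen 0 * gen 4) ((ε ^ 2) • (gen 4 * gen 0))
  | KF : Rel ε (gen 0 * gen 5) ((ε ^ 2)⁻¹ • (gen 5 * gen 0))
  | LE : Rel ε (gen 2 * gen 4) ((ε ^ 2) • (gen 4 * gen 2))
  | LF : Rel ε (gen 2 * gen 5) ((ε ^ 2)⁻¹ • (gen 5 * gen 2))
  | EF : Rel ε (gen 4 * gen 5 - gen 5 * gen 4) ((ε - ε⁻¹) • (gen 0 - gen 3))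

/-- The algebra `𝒰_ε`: the quotient of the free algebra on
`K, K⁻¹, L, L⁻¹, E, F` over `ℂ` by the two-sided ideal generated by the
defining relations. -/
abbrev U (ε : ℂ) := RingQuot (Rel ε)

noncomputable def K (ε : ℂ) : U ε := RingQuot.mkAlgHom ℂ (Rel ε) (gen 0)
noncomputable def Kinv (ε : ℂ) : U ε := RingQuot.mkAlgHom ℂ (Rel ε) (gen 1)
noncomputable def L (ε : ℂ) : U ε := RingQuot.mkAlgHom ℂ (Rel ε) (gen 2)
noncomputable def Linv (ε : ℂ) : U ε := RingQuot.mkAlgHom ℂ (Rel ε) (gen 3)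
noncomputable def E (ε : ℂ) : U ε := RingQuot.mkAlgHom ℂ (Rel ε) (gen 4)
noncomputable def F (ε : ℂ) : U ε := RingQuot.mkAlgHom ℂ (Rel ε) (gen 5)

section Commutation

variable {R A : Type*} [CommRing R] [Ring A] [Algebra R A]

theorem mul_pow_of_mul_eq_smul {q : R} {x y : A} (h : x * y = q • (y * x)) (n : ℕ) :
    x * y ^ n = q ^ n • (y ^ n * x) := by
  induction n with
  | zero => simp
  | succ n ih =>
    rw [pow_succ, ← mul_assoc, ih, smul_mul_assoc, mul_assoc, h, mul_smul_comm, smul_smul,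
      ← pow_succ, ← mul_assoc]

theorem pow_mul_of_mul_eq_smul {q : R} {x y : A} (h : x * y = q • (y * x)) (n : ℕ) :
    x ^ n * y = q ^ n • (y * x ^ n) := by
  induction n with
  | zero => simp
  | succ n ih =>
    rw [pow_succ', mul_assoc, ih, mul_smul_comm, ← mul_assoc, h, smul_mul_assoc, smul_smul,
      ← pow_succ, mul_assoc]

theorem commute_pow_right_of_mul_eq_smul {q : R} {x y : A} (h : x * y = q • (y * x)) {n : ℕ}
    (hq : q ^ n = 1) : Commute x (y ^ n) := by
  rw [commute_iff_eq, mul_pow_of_mul_eq_smul h n, hq, one_smul]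

theorem commute_pow_left_of_mul_eq_smul {q : R} {x y : A} (h : x * y = q • (y * x)) {n : ℕ}
    (hq : q ^ n = 1) : Commute (x ^ n) y := by
  rw [commute_iff_eq, pow_mul_of_mul_eq_smul h n, hq, one_smul]

theorem pow_succ_mul_sub_mul_pow_succ {q r c : R} {x y a b : A}
    (hxy : x * y - y * x = c • (a - b)) (ha : a * x = q • (x * a)) (hb : b * x = r • (x * b))
    (n : ℕ) :
    x ^ (n + 1) * y - y * x ^ (n + 1) =
      c • ((∑ i ∈ Finset.range (n + 1), q ^ i) • (x ^ n * a) -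
        (∑ i ∈ Finset.range (n + 1), r ^ i) • (x ^ n * b)) := by
  induction n with
  | zero => simpa using hxy
  | succ n ih =>
    have key : x ^ (n + 1 + 1) * y - y * x ^ (n + 1 + 1) =
        x ^ (n + 1) * (x * y - y * x) + (x ^ (n + 1) * y - y * x ^ (n + 1)) * x := by
      rw [pow_succ x (n + 1)]
      noncomm_ring
    rw [key, hxy, ih, geom_sum_succ (n := n + 1) (x := q), geom_sum_succ (n := n + 1) (x := r)]
    simp only [mul_smul_comm, smul_mul_assoc, sub_mul, mul_sub, mul_assoc, ha, hb]
    simp only [← mul_assoc, ← pow_succ]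
    module

theorem commute_pow_of_geom_sum_eq_zero {q r c : R} {x y a b : A}
    (hxy : x * y - y * x = c • (a - b)) (ha : a * x = q • (x * a)) (hb : b * x = r • (x * b))
    {n : ℕ} (hq : ∑ i ∈ Finset.range n, q ^ i = 0) (hr : ∑ i ∈ Finset.range n, r ^ i = 0) :
    Commute (x ^ n) y := by
  cases n with
  | zero => simp
  | succ n =>
    have h := pow_succ_mul_sub_mul_pow_succ hxy ha hb n
    rw [hq, hr] at h
    exact sub_eq_zero.mp (by simpa using h)

end Commutation

theorem commute_of_mul_eq_one {M : Type*} [Monoid M] {a b z : M} (hab : a * b = 1)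
    (hba : b * a = 1) (h : Commute z a) : Commute z b :=
  Commute.units_inv_right (u := ⟨a, b, hab, hba⟩) h

theorem inv_mul_eq_smul {k A : Type*} [Field k] [Ring A] [Algebra k A] {q : k} (hq : q ≠ 0)
    {a b x : A} (hab : a * b = 1) (hba : b * a = 1) (h : a * x = q • (x * a)) :
    b * x = q⁻¹ • (x * b) := by
  have hx : x * b = q • (b * x) := by
    calc x * b = b * (a * x) * b := by rw [← mul_assoc, hba, one_mul]
      _ = q • (b * x * (a * b)) := by
        rw [h, mul_smul_comm, smul_mul_assoc]
        simp only [mul_assoc]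
      _ = q • (b * x) := by rw [hab, mul_one]
  rw [hx, smul_smul, inv_mul_cancel₀ hq, one_smul]

section Relations

variable (ε : ℂ)

theorem K_mul_Kinv : K ε * Kinv ε = 1 := by
  simpa [K, Kinv] using RingQuot.mkAlgHom_rel ℂ (Rel.KKinv (ε := ε))

theorem Kinv_mul_K : Kinv ε * K ε = 1 := by
  simpa [K, Kinv] using RingQuot.mkAlgHom_rel ℂ (Rel.KinvK (ε := ε))

theorem L_mul_Linv : L ε * Linv ε = 1 := by
  simpa [L, Linv] using RingQuot.mkAlgHom_rel ℂ (Rel.LLinv (ε := ε))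

theorem Linv_mul_L : Linv ε * L ε = 1 := by
  simpa [L, Linv] using RingQuot.mkAlgHom_rel ℂ (Rel.LinvL (ε := ε))

theorem commute_K_L : Commute (K ε) (L ε) := by
  simpa [K, L, commute_iff_eq] using RingQuot.mkAlgHom_rel ℂ (Rel.KL (ε := ε))

theorem K_mul_E : K ε * E ε = (ε ^ 2) • (E ε * K ε) := by
  have h := RingQuot.mkAlgHom_rel ℂ (Rel.KE (ε := ε))
  simp only [map_mul, map_smul] at h
  exact h

theorem K_mul_F : K ε * F ε = (ε ^ 2)⁻¹ • (F ε * K ε) := by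
  have h := RingQuot.mkAlgHom_rel ℂ (Rel.KF (ε := ε))
  simp only [map_mul, map_smul] at h
  exact h

theorem L_mul_E : L ε * E ε = (ε ^ 2) • (E ε * L ε) := by
  have h := RingQuot.mkAlgHom_rel ℂ (Rel.LE (ε := ε))
  simp only [map_mul, map_smul] at h
  exact h

theorem L_mul_F : L ε * F ε = (ε ^ 2)⁻¹ • (F ε * L ε) := by
  have h := RingQuot.mkAlgHom_rel ℂ (Rel.LF (ε := ε))
  simp only [map_mul, map_smul] at h
  exact h

theorem E_mul_F_sub : E ε * F ε - F ε * E ε = (ε - ε⁻¹) • (K ε - Linv ε) := by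
  have h := RingQuot.mkAlgHom_rel ℂ (Rel.EF (ε := ε))
  simp only [map_mul, map_smul, map_sub] at h
  exact h

theorem F_mul_E_sub : F ε * E ε - E ε * F ε = (-(ε - ε⁻¹)) • (K ε - Linv ε) := by
  rw [← neg_sub, E_mul_F_sub]
  exact (neg_smul (ε - ε⁻¹) (K ε - Linv ε)).symm

end Relations

theorem commute_generators {ε : ℂ} {z : U ε} (hK : Commute z (K ε)) (hL : Commute z (L ε))
    (hE : Commute z (E ε)) (hF : Commute z (F ε)) :
    ∀ g ∈ ({K ε, Kinv ε, L ε, Linv ε, E ε, F ε} : Set (U ε)), Commute z g := by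
  rintro g (rfl | rfl | rfl | rfl | rfl | rfl)
  · exact hK
  · exact commute_of_mul_eq_one (K_mul_Kinv ε) (Kinv_mul_K ε) hK
  · exact hL
  · exact commute_of_mul_eq_one (L_mul_Linv ε) (Linv_mul_L ε) hL
  · exact hE
  · exact hF

/-- For `ℓ` odd, `ℓ ≥ 3`, and `ε ∈ ℂ` a primitive `ℓ`-th root of
unity, the elements `E^ℓ, F^ℓ, K^ℓ, K^{-ℓ}, L^ℓ, L^{-ℓ}` of `𝒰_ε` are central:
each commutes with all of `K, K⁻¹, L, L⁻¹, E, F`. -/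
theorem stmt_16 (ℓ : ℕ) (hodd : Odd ℓ) (hℓ : 3 ≤ ℓ) (ε : ℂ)
    (hε : IsPrimitiveRoot ε ℓ) :
    ∀ z ∈ ({E ε ^ ℓ, F ε ^ ℓ, K ε ^ ℓ, Kinv ε ^ ℓ, L ε ^ ℓ, Linv ε ^ ℓ} :
        Set (U ε)),
      ∀ g ∈ ({K ε, Kinv ε, L ε, Linv ε, E ε, F ε} : Set (U ε)),
        z * g = g * z := by
  have hq : IsPrimitiveRoot (ε ^ 2) ℓ :=
    hε.pow_of_coprime 2 (Nat.coprime_two_left.mpr hodd)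
  have hq0 : ε ^ 2 ≠ 0 := hq.ne_zero (by omega)
  have hgeom := hq.geom_sum_eq_zero (by omega)
  have hgeom_inv := hq.inv.geom_sum_eq_zero (by omega)
  have h1 := hq.pow_eq_one
  have h1_inv := hq.inv.pow_eq_one
  have hLinvE := inv_mul_eq_smul hq0 (L_mul_Linv ε) (Linv_mul_L ε) (L_mul_E ε)
  have hLinvF : Linv ε * F ε = (ε ^ 2) • (F ε * Linv ε) := by
    simpa only [inv_inv] using
      inv_mul_eq_smul (inv_ne_zero hq0) (L_mul_Linv ε) (Linv_mul_L ε) (L_mul_F ε)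
  have hE := commute_generators
    (commute_pow_right_of_mul_eq_smul (K_mul_E ε) h1).symm
    (commute_pow_right_of_mul_eq_smul (L_mul_E ε) h1).symm
    ((Commute.refl (E ε)).pow_left ℓ)
    (commute_pow_of_geom_sum_eq_zero (E_mul_F_sub ε) (K_mul_E ε) hLinvE hgeom hgeom_inv)
  have hF := commute_generators
    (commute_pow_right_of_mul_eq_smul (K_mul_F ε) h1_inv).symm
    (commute_pow_right_of_mul_eq_smul (L_mul_F ε) h1_inv).symm
    (commute_pow_of_geom_sum_eq_zero (F_mul_E_sub ε) (K_mul_F ε) hLinvF hgeom_inv hgeom)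
    ((Commute.refl (F ε)).pow_left ℓ)
  have hK := commute_generators
    ((Commute.refl (K ε)).pow_left ℓ)
    ((commute_K_L ε).pow_left ℓ)
    (commute_pow_left_of_mul_eq_smul (K_mul_E ε) h1)
    (commute_pow_left_of_mul_eq_smul (K_mul_F ε) h1_inv)
  have hL := commute_generators
    ((commute_K_L ε).symm.pow_left ℓ)
    ((Commute.refl (L ε)).pow_left ℓ)
    (commute_pow_left_of_mul_eq_smul (L_mul_E ε) h1)
    (commute_pow_left_of_mul_eq_smul (L_mul_F ε) h1_inv)
  have pow_inv {a b : U ε} (hab : a * b = 1) (hba : b * a = 1) {g : U ε}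
      (h : Commute (a ^ ℓ) g) : Commute (b ^ ℓ) g := by
    have hcomm : Commute a b := hab.trans hba.symm
    refine (commute_of_mul_eq_one ?_ ?_ h.symm).symm
    · rw [← hcomm.mul_pow, hab, one_pow]
    · rw [← hcomm.symm.mul_pow, hba, one_pow]
  rintro z (rfl | rfl | rfl | rfl | rfl | rfl) g hg
  · exact hE g hg
  · exact hF g hg
  · exact hK g hg
  · exact pow_inv (K_mul_Kinv ε) (Kinv_mul_K ε) (hK g hg)
  · exact hL g hg
  · exact pow_inv (L_mul_Linv ε) (Linv_mul_L ε) (hL g hg)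

end Stmt16
end
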